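/- The set of right-regular permutations of an oriented Steiner quasigroup, i.e. the set of bijections σ : Q × ℤˣ → Q × ℤˣ satisfying σ(z ∘ w) = z ∘ σ(w) for all z, w, is exactly {id, σ₀}, where σ₀(a,α) = (a,-α); in particular, this group of permutations is isomorphic to the group Z₂ whenever Q is nonempty. -/

import Mathlib

/-- A map commuting with all left translations of the double cover of a Steiner quasigroup
preserves the first coordinate. -/
theorem fst_eq_of_commute_op {Q : Type*} (mul : Q → Q → Q)
    (hidem : ∀ x, mul x x = x) (hcomm : ∀ x y, mul x y = mul y x)
    (hkey : ∀ x y, mul x (mul x y) = y) (f : Q → Q → ℤˣ)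
    (op : Q × ℤˣ → Q × ℤˣ → Q × ℤˣ)
    (hop : ∀ (a b : Q) (α β : ℤˣ), op (a, α) (b, β) = (mul a b, f a b * α * β))
    (σ : Q × ℤˣ → Q × ℤˣ) (h : ∀ z w, σ (op z w) = op z (σ w)) (z : Q × ℤˣ) :
    (σ z).1 = z.1 := by
  obtain ⟨a, α⟩ := z
  have key := h (a, f a a) (a, α)
  rw [hop, hidem, Int.units_mul_self, one_mul, ← Prod.mk.eta (p := σ (a, α)), hop] at key
  have hfix : (σ (a, α)).1 = mul a (σ (a, α)).1 := congrArg Prod.fst key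
  calc (σ (a, α)).1 = mul (σ (a, α)).1 (σ (a, α)).1 := (hidem _).symm
    _ = mul (σ (a, α)).1 (mul (σ (a, α)).1 a) := by rw [hcomm _ a, ← hfix]
    _ = a := hkey _ _

/-- The right-regular permutations of an oriented Steiner quasigroup are exactly
`{id, σ₀}` where `σ₀(a,α) = (a,-α)`; in particular this group is isomorphic to `Z₂`
whenever `Q` is nonempty. -/
theorem stmt_14 {Q : Type*} (mul : Q → Q → Q)
    (hidem : ∀ x, mul x x = x)
    (hcomm : ∀ x y, mul x y = mul y x)
    (hkey : ∀ x y, mul x (mul x y) = y)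
    (ε : ℤˣ) (f : Q → Q → ℤˣ)
    (hf1 : ∀ x, f x x = ε)
    (hf2 : ∀ x y, x ≠ y → f x y * f y x = -1)
    (hf3 : ∀ x y, x ≠ y → f x y = f y (mul x y))
    (op : Q × ℤˣ → Q × ℤˣ → Q × ℤˣ)
    (hop : ∀ (a b : Q) (α β : ℤˣ), op (a, α) (b, β) = (mul a b, f a b * α * β)) :
    ({σ : Q × ℤˣ → Q × ℤˣ | Function.Bijective σ ∧ ∀ z w, σ (op z w) = op z (σ w)}
        = {id, fun z => (z.1, -z.2)}) ∧
    (Nonempty Q →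
      Nonempty ({σ : Q × ℤˣ → Q × ℤˣ //
        Function.Bijective σ ∧ ∀ z w, σ (op z w) = op z (σ w)} ≃ ZMod 2)) := by
  have hset : {σ : Q × ℤˣ → Q × ℤˣ | Function.Bijective σ ∧ ∀ z w, σ (op z w) = op z (σ w)}
      = {id, fun z => (z.1, -z.2)} := by
    ext σ
    simp only [Set.mem_ofPred_eq, Set.mem_insert_iff, Set.mem_singleton_iff]
    constructor
    · rintro ⟨-, h⟩
      have hfst : ∀ z, (σ z).1 = z.1 :=
        fst_eq_of_commute_op mul hidem hcomm hkey f op hop σ h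
      have htrans : ∀ a c (u : ℤˣ), (σ (c, u)).2 = u * (σ (a, 1)).2 := by
        intro a c u
        have hmul : mul (mul a c) a = c := by rw [hcomm, hkey]
        have hσ : σ (a, 1) = (a, (σ (a, 1)).2) := Prod.ext (hfst _) rfl
        have key := h (mul a c, f (mul a c) a * u) (a, 1)
        rw [hσ, hop, hop, hmul, ← mul_assoc, Int.units_mul_self, one_mul, mul_one] at key
        rw [key]
      by_cases hQ : Nonempty Q
      · obtain ⟨a⟩ := hQ
        rcases Int.units_eq_one_or (σ (a, 1)).2 with hc | hc
        · exact Or.inl (funext fun z => Prod.ext (hfst z) (by simp [htrans a z.1 z.2, hc]))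
        · exact Or.inr (funext fun z => Prod.ext (hfst z) (by simp [htrans a z.1 z.2, hc]))
      · exact Or.inl (funext fun z => (hQ ⟨z.1⟩).elim)
    · rintro (rfl | rfl)
      · exact ⟨Function.bijective_id, fun _ _ => rfl⟩
      · refine ⟨Function.Involutive.bijective fun z => by simp, ?_⟩
        rintro ⟨a, α⟩ ⟨b, β⟩
        simp [hop]
  refine ⟨hset, fun ⟨a⟩ => ?_⟩
  have hne : (id : Q × ℤˣ → Q × ℤˣ) ≠ fun z => (z.1, -z.2) := by
    intro h
    have h1 : (1 : ℤˣ) = -1 := congrArg Prod.snd (congrFun h (a, 1))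
    exact absurd h1 (by decide)
  have hcard : Nat.card {σ : Q × ℤˣ → Q × ℤˣ //
      Function.Bijective σ ∧ ∀ z w, σ (op z w) = op z (σ w)} = 2 := by
    have := Set.ncard_pair hne
    rwa [← hset] at this
  exact ⟨Nat.equivFinOfCardPos (hcard ▸ two_ne_zero) |>.trans (finCongr hcard)⟩
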